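/- arXiv:2207.07451 — 3 statements merged into one kernel-verified Lean document; each statement's English description precedes it below -/
import Mathlib

section
/- In the unitary group of d×d complex matrices (with its topology as a subset of the matrix space), the set of unitary matrices all of whose minors are nonzero is open and dense. -/
/-- All minors of a square matrix are nonzero: for every `1 ≤ k ≤ d` and every pair of
injections `σ τ : Fin k → Fin d`, the determinant of the corresponding `k × k`
submatrix is nonzero. -/
def AllMinorsNonzero {d : ℕ} (U : Matrix (Fin d) (Fin d) ℂ) : Prop :=
  ∀ k : ℕ, 1 ≤ k → k ≤ d → ∀ σ τ : Fin k → Fin d,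
    Function.Injective σ → Function.Injective τ →
      (Matrix.of fun r s : Fin k => U (σ r) (τ s)).det ≠ 0

open Polynomial in
/-- The minors of `V * (W + z) * adj (1 + z W)` depend polynomially on `z`. -/
theorem exists_polynomial_eval_eq_det_submatrix {n m R : Type*} [Fintype n] [DecidableEq n]
    [Fintype m] [DecidableEq m] [CommRing R] (V W : Matrix n n R) (σ τ : m → n) :
    ∃ p : R[X], ∀ z : R,
      p.eval z = ((V * (W + z • 1) * (1 + z • W).adjugate).submatrix σ τ).det := by
  refine ⟨(((C.mapMatrix V) * (C.mapMatrix W + (X : R[X]) • 1) *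
    (1 + (X : R[X]) • C.mapMatrix W).adjugate).submatrix σ τ).det, fun z => ?_⟩
  have hC : ∀ M : Matrix n n R, (evalRingHom z).mapMatrix (C.mapMatrix M) = M := by
    intro M; ext; simp
  have hX : ∀ M : Matrix n n R[X], (evalRingHom z).mapMatrix ((X : R[X]) • M) =
      z • (evalRingHom z).mapMatrix M := by
    intro M; ext; simp
  rw [← coe_evalRingHom, RingHom.map_det, RingHom.mapMatrix_apply, ← Matrix.submatrix_map,
    ← RingHom.mapMatrix_apply]
  simp only [map_mul, map_add, map_one, RingHom.map_adjugate, hC, hX]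

open Polynomial in
theorem exists_polynomial_eval_eq_det_one_add_smul {n R : Type*} [Fintype n] [DecidableEq n]
    [CommRing R] (W : Matrix n n R) :
    ∃ q : R[X], ∀ z : R, q.eval z = (1 + z • W).det := by
  refine ⟨(1 + (X : R[X]) • C.mapMatrix W).det, fun z => ?_⟩
  rw [← coe_evalRingHom, RingHom.map_det]
  congr 1
  ext i j
  simp [Matrix.one_apply, apply_ite, mul_comm z]

theorem exists_circle_det_one_add_smul_ne_zero {n : Type*} [Fintype n] [DecidableEq n]
    (W : Matrix n n ℂ) : ∃ u : Circle, (1 + (u : ℂ) • W).det ≠ 0 := by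
  obtain ⟨q, hq⟩ := exists_polynomial_eval_eq_det_one_add_smul W
  have hq0 : q ≠ 0 := by
    rintro rfl
    simpa using hq 0
  by_contra! h
  have : Infinite (Set.Ioc (-Real.pi) Real.pi) :=
    (Set.Ioc_infinite (by linarith [Real.pi_pos])).to_subtype
  have : Infinite Circle := Circle.argEquiv.infinite_iff.2 this
  refine hq0 (q.eq_zero_of_infinite_isRoot ((Set.infinite_range_of_injective (α := Circle)
    Circle.coe_injective).mono ?_))
  rintro _ ⟨u, rfl⟩
  exact (hq u).trans (h u)

/-- The Möbius transform `w ↦ (w + c) / (1 + c w)` with `c` real preserves unitarity. -/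
theorem add_smul_one_mul_inv_mem_unitaryGroup {n : Type*} [Fintype n] [DecidableEq n]
    {W : Matrix n n ℂ} (hW : W ∈ Matrix.unitaryGroup n ℂ) (c : ℝ)
    (hc : (1 + (c : ℂ) • W).det ≠ 0) :
    (W + (c : ℂ) • 1) * (1 + (c : ℂ) • W)⁻¹ ∈ Matrix.unitaryGroup n ℂ := by
  have hW' : star W * W = 1 := Matrix.mem_unitaryGroup_iff'.1 hW
  set B := 1 + (c : ℂ) • W with hB
  have hstar : star (W + (c : ℂ) • 1) * (W + (c : ℂ) • 1) = star B * B := by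
    simp only [hB, star_add, star_smul, star_one, add_mul, mul_add, smul_mul_assoc,
      mul_smul_comm, hW', mul_one, one_mul, smul_add, RCLike.star_def, Complex.conj_ofReal]
    abel
  have hu : IsUnit B.det := isUnit_iff_ne_zero.2 hc
  rw [Matrix.mem_unitaryGroup_iff', star_mul]
  calc star B⁻¹ * star (W + (c : ℂ) • 1) * ((W + (c : ℂ) • 1) * B⁻¹)
      = star B⁻¹ * (star (W + (c : ℂ) • 1) * (W + (c : ℂ) • 1)) * B⁻¹ := by
        simp only [mul_assoc]
    _ = star (B * B⁻¹) * (B * B⁻¹) := by rw [hstar, star_mul]; simp only [mul_assoc]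
    _ = 1 := by rw [Matrix.mul_nonsing_inv B hu]; simp

open Topology in
/-- If `U * W` has a nonzero minor at a given position and `1 + W` is invertible, then `U` is a
limit of unitary matrices for which that minor is nonzero. -/
theorem mem_closure_det_submatrix_ne_zero {n m : Type*} [Fintype n] [DecidableEq n]
    [Fintype m] [DecidableEq m] (σ τ : m → n) (U W : Matrix.unitaryGroup n ℂ)
    (hUW : (((U * W : Matrix.unitaryGroup n ℂ) : Matrix n n ℂ).submatrix σ τ).det ≠ 0)
    (hW : (1 + (W : Matrix n n ℂ)).det ≠ 0) :
    U ∈ closure {U : Matrix.unitaryGroup n ℂ | ((U : Matrix n n ℂ).submatrix σ τ).det ≠ 0} := by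
  obtain ⟨p, hp⟩ := exists_polynomial_eval_eq_det_submatrix (U : Matrix n n ℂ) W σ τ
  obtain ⟨q, hq⟩ := exists_polynomial_eval_eq_det_one_add_smul (W : Matrix n n ℂ)
  have hp0 : p ≠ 0 := by
    rintro rfl
    exact hUW (by simpa using (hp 0).symm)
  have hq0 : q ≠ 0 := by
    rintro rfl
    simpa using hq 0
  let f : ℝ → Matrix n n ℂ := fun c =>
    (1 + (c : ℂ) • (W : Matrix n n ℂ)).det⁻¹ •
      ((U : Matrix n n ℂ) * (W + (c : ℂ) • 1) * (1 + (c : ℂ) • (W : Matrix n n ℂ)).adjugate)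
  have hf : ∀ c, f c = U * ((W + (c : ℂ) • 1) * (1 + (c : ℂ) • (W : Matrix n n ℂ))⁻¹) := by
    intro c
    simp only [f, Matrix.inv_def, Ring.inverse_eq_inv', mul_smul_comm, mul_assoc]
  have hf1 : f 1 = U := by
    rw [hf, add_comm (W : Matrix n n ℂ)]
    simp [Matrix.mul_nonsing_inv _ (isUnit_iff_ne_zero.2 hW)]
  have hcont : ContinuousAt f 1 := by
    have hB : Continuous fun c : ℝ => 1 + (c : ℂ) • (W : Matrix n n ℂ) := by fun_prop
    have hA : Continuous fun c : ℝ => (U : Matrix n n ℂ) * (W + (c : ℂ) • 1) := by fun_prop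
    exact (hB.matrix_det.continuousAt.inv₀ (by simpa using hW)).smul
      (hA.matrix_mul hB.matrix_adjugate).continuousAt
  rw [closure_subtype, ← hf1]
  refine mem_closure_of_tendsto (b := 𝓝[≠] (1 : ℝ)) (hcont.tendsto.mono_left nhdsWithin_le_nhds)
    (Filter.Eventually.filter_mono (nhdsNE_le_cofinite (1 : ℝ)) ?_)
  have hfin : ∀ r : Polynomial ℂ, r ≠ 0 → ∀ᶠ c : ℝ in Filter.cofinite, r.eval (c : ℂ) ≠ 0 := by
    intro r hr
    refine Complex.ofReal_injective.tendsto_cofinite.eventually (p := fun z => r.eval z ≠ 0) ?_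
    simpa [Filter.eventually_cofinite] using Polynomial.finite_setOfPred_isRoot hr
  filter_upwards [hfin p hp0, hfin q hq0] with c hpc hqc
  rw [hp] at hpc
  rw [hq] at hqc
  refine ⟨⟨f c, ?_⟩, ?_, rfl⟩
  · rw [hf]
    exact mul_mem U.2 (add_smul_one_mul_inv_mem_unitaryGroup W.2 c hqc)
  · change ((f c).submatrix σ τ).det ≠ 0
    simp only [f, Matrix.submatrix_smul, Pi.smul_apply, Matrix.det_smul]
    exact mul_ne_zero (pow_ne_zero _ (inv_ne_zero hqc)) hpc

theorem exists_unitary_submatrix_eq_one {n m : Type*} [Fintype n] [DecidableEq n]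
    [Fintype m] [DecidableEq m] {σ τ : m → n} (hσ : Function.Injective σ)
    (hτ : Function.Injective τ) :
    ∃ P : Matrix.unitaryGroup n ℂ, (P : Matrix n n ℂ).submatrix σ τ = 1 := by
  obtain ⟨e, he⟩ : ∃ e : Equiv.Perm n, ∀ i, e (σ i) = τ i := by
    let g : {x // x ∈ Set.range σ} ≃ {x // x ∈ Set.range τ} :=
      (Equiv.ofInjective σ hσ).symm.trans (Equiv.ofInjective τ hτ)
    classical
    refine ⟨g.extendSubtype, fun i => ?_⟩
    rw [Equiv.extendSubtype_apply_of_mem _ _ ⟨i, rfl⟩]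
    simp [g, Equiv.ofInjective_symm_apply]
  refine ⟨⟨e.permMatrix ℂ, ?_⟩, ?_⟩
  · rw [Matrix.mem_unitaryGroup_iff', Matrix.star_eq_conjTranspose,
      Matrix.conjTranspose_permMatrix, ← Matrix.permMatrix_mul]
    simp
  · ext i j
    simp [Equiv.Perm.permMatrix, PEquiv.toMatrix_apply, Matrix.one_apply, he, hτ.eq_iff]

theorem dense_det_submatrix_ne_zero {n m : Type*} [Fintype n] [DecidableEq n]
    [Fintype m] [DecidableEq m] {σ τ : m → n} (hσ : Function.Injective σ)
    (hτ : Function.Injective τ) :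
    Dense {U : Matrix.unitaryGroup n ℂ | ((U : Matrix n n ℂ).submatrix σ τ).det ≠ 0} := by
  intro U
  obtain ⟨P, hP⟩ := exists_unitary_submatrix_eq_one hσ hτ
  obtain ⟨u, hu⟩ := exists_circle_det_one_add_smul_ne_zero
    ((U⁻¹ * P : Matrix.unitaryGroup n ℂ) : Matrix n n ℂ)
  have hmem : (u : ℂ) • ((U⁻¹ * P : Matrix.unitaryGroup n ℂ) : Matrix n n ℂ) ∈
      Matrix.unitaryGroup n ℂ := by
    rw [Matrix.mem_unitaryGroup_iff', star_smul, smul_mul_smul_comm,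
      Matrix.mem_unitaryGroup_iff'.1 (U⁻¹ * P).2, RCLike.star_def, ← Circle.coe_inv_eq_conj]
    simp
  refine mem_closure_det_submatrix_ne_zero σ τ U ⟨_, hmem⟩ ?_ hu
  have : ((U * ⟨_, hmem⟩ : Matrix.unitaryGroup n ℂ) : Matrix n n ℂ) = (u : ℂ) • P := by
    rw [Submonoid.coe_mul, mul_smul_comm, ← Submonoid.coe_mul, mul_inv_cancel_left]
  rw [this, Matrix.submatrix_smul, Pi.smul_apply, Pi.smul_apply, hP, Matrix.det_smul]
  simp

theorem isOpen_det_submatrix_ne_zero {n m : Type*} [Fintype n] [DecidableEq n]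
    [Fintype m] [DecidableEq m] (σ τ : m → n) :
    IsOpen {U : Matrix.unitaryGroup n ℂ | ((U : Matrix n n ℂ).submatrix σ τ).det ≠ 0} :=
  isOpen_ne.preimage (continuous_subtype_val.matrix_submatrix σ τ).matrix_det

theorem isOpen_dense_iInter_of_finite {X ι : Type*} [TopologicalSpace X] [Finite ι]
    {s : ι → Set X} (ho : ∀ i, IsOpen (s i)) (hd : ∀ i, Dense (s i)) :
    IsOpen (⋂ i, s i) ∧ Dense (⋂ i, s i) := by
  refine ⟨isOpen_iInter_of_finite ho, ?_⟩
  rw [← Set.sInter_range]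
  exact (Set.finite_range s).dense_sInter (by rintro _ ⟨i, rfl⟩; exact ho i)
    (by rintro _ ⟨i, rfl⟩; exact hd i)

/-- In the unitary group of `d × d` complex matrices, the set of
matrices all of whose minors are nonzero is open and dense. -/
theorem stmt_6 (d : ℕ) (hd : 1 ≤ d) :
    IsOpen {U : Matrix.unitaryGroup (Fin d) ℂ |
        AllMinorsNonzero (U : Matrix (Fin d) (Fin d) ℂ)} ∧
    Dense {U : Matrix.unitaryGroup (Fin d) ℂ |
        AllMinorsNonzero (U : Matrix (Fin d) (Fin d) ℂ)} := by
  have heq : {U : Matrix.unitaryGroup (Fin d) ℂ |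
        AllMinorsNonzero (U : Matrix (Fin d) (Fin d) ℂ)} =
      ⋂ i : Σ k : Set.Icc 1 d, (Fin k ↪ Fin d) × (Fin k ↪ Fin d),
        {U : Matrix.unitaryGroup (Fin d) ℂ |
          ((U : Matrix (Fin d) (Fin d) ℂ).submatrix i.2.1 i.2.2).det ≠ 0} := by
    ext U
    simp only [Set.mem_iInter, Set.mem_ofPred_eq]
    exact ⟨fun h i => h i.1 i.1.2.1 i.1.2.2 _ _ i.2.1.injective i.2.2.injective,
      fun h k h1 hk σ τ hσ hτ => h ⟨⟨k, h1, hk⟩, ⟨σ, hσ⟩, ⟨τ, hτ⟩⟩⟩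
  rw [heq]
  exact isOpen_dense_iInter_of_finite (fun i => isOpen_det_submatrix_ne_zero _ _)
    (fun i => dense_det_submatrix_ne_zero i.2.1.injective i.2.2.injective)
end

section
/- For every d ≥ 2 and every real m with 0 < m < 1/√d there exists a d×d unitary matrix U such that all minors of U are nonzero and m ≤ |U_{ij}| for all i, j (so the associated pair of orthonormal bases is completely incompatible with m ≤ m_AB ≤ 1/√d). -/
open Filter Topology Polynomial Matrix

theorem Polynomial.eventually_cofinite_eval_ne_zero {p : ℂ[X]} (hp : p ≠ 0) :
    ∀ᶠ z in cofinite, p.eval z ≠ 0 := by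
  have h := p.roots.toFinset.finite_toSet
  refine h.subset fun z hz => ?_
  simpa [hp] using hz

theorem Equiv.Perm.exists_comp_eq {ι n : Type*} [Finite n] {σ τ : ι → n}
    (hσ : Function.Injective σ) (hτ : Function.Injective τ) :
    ∃ π : Equiv.Perm n, ∀ r, π (σ r) = τ r := by
  classical
  have := Fintype.ofFinite n
  refine ⟨((Equiv.ofInjective σ hσ).symm.trans (Equiv.ofInjective τ hτ)).extendSubtype,
    fun r => ?_⟩
  rw [Equiv.extendSubtype_apply_of_mem _ _ ⟨r, rfl⟩]
  simp [Equiv.ofInjective_symm_apply]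

theorem dense_iInter_of_isOpen_of_finite {X ι : Type*} [TopologicalSpace X] [Finite ι]
    {f : ι → Set X} (ho : ∀ i, IsOpen (f i)) (hd : ∀ i, Dense (f i)) : Dense (⋂ i, f i) := by
  classical
  have := Fintype.ofFinite ι
  suffices h : ∀ s : Finset ι, Dense (⋂ i ∈ s, f i) by simpa using h Finset.univ
  intro s
  induction s using Finset.induction_on with
  | empty => simp
  | insert a s _ ih =>
    rw [Finset.set_biInter_insert]
    exact (hd a).inter_of_isOpen_left ih (ho a)

namespace Matrix

variable {n ι : Type*} [Fintype n] [DecidableEq n] [Fintype ι] [DecidableEq ι]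

theorem exists_mem_unitaryGroup_det_submatrix_ne_zero {σ τ : ι → n}
    (hσ : Function.Injective σ) (hτ : Function.Injective τ) :
    ∃ V ∈ unitaryGroup n ℂ, (V.submatrix σ τ).det ≠ 0 := by
  obtain ⟨π, hπ⟩ := Equiv.Perm.exists_comp_eq hσ hτ
  refine ⟨π.permMatrix ℂ, ?_, ?_⟩
  · rw [mem_unitaryGroup_iff, star_eq_conjTranspose, conjTranspose_permMatrix,
      ← permMatrix_mul]
    simp
  · have : (π.permMatrix ℂ).submatrix σ τ = 1 := by
      ext r s
      simp [Equiv.Perm.permMatrix, PEquiv.toMatrix_apply, hπ, one_apply, hτ.eq_iff]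
    simp [this]

theorem exists_norm_eq_one_det_one_add_smul_ne_zero (W : Matrix n n ℂ) :
    ∃ c : ℂ, ‖c‖ = 1 ∧ (1 + c • W).det ≠ 0 := by
  let p : ℂ[X] := (1 + (X : ℂ[X]) • W.map C).det
  have hp (z : ℂ) : p.eval z = (1 + z • W).det := by
    rw [← coe_evalRingHom, RingHom.map_det]
    congr 1
    ext i j
    simp [one_apply, apply_ite (eval z), mul_comm (W i j)]
  have hp0 : p ≠ 0 := by
    intro h
    have := hp 0
    simp [h] at this
  have hinf : (Metric.sphere (0 : ℂ) 1).Infinite := by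
    refine (isPreconnected_sphere (by simp) 0 1).infinite_of_nontrivial ?_
    exact ⟨1, by simp, -1, by simp, by norm_num⟩
  obtain ⟨c, hc, hc'⟩ := (hinf.frequently_cofinite.and_eventually
    (Polynomial.eventually_cofinite_eval_ne_zero hp0)).exists
  exact ⟨c, by simpa using hc, hp c ▸ hc'⟩

theorem add_smul_one_mul_inv_mem_unitaryGroup {W : Matrix n n ℂ} (hW : W ∈ unitaryGroup n ℂ)
    (r : ℝ) (h : (1 + (r : ℂ) • W).det ≠ 0) :
    (W + (r : ℂ) • 1) * (1 + (r : ℂ) • W)⁻¹ ∈ unitaryGroup n ℂ := by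
  set M := 1 + (r : ℂ) • W
  have hM : IsUnit M.det := h.isUnit
  have key : star (W + (r : ℂ) • 1) * (W + (r : ℂ) • 1) = star M * M := by
    have := mem_unitaryGroup_iff'.1 hW
    simp only [M, star_add, star_smul, star_one, add_mul, mul_add, smul_mul_assoc,
      mul_smul_comm, this, mul_one, one_mul]
    simp
    abel
  rw [mem_unitaryGroup_iff', star_mul, mul_assoc, ← mul_assoc (star _) _ M⁻¹, key,
    mul_assoc (star M), mul_nonsing_inv _ hM, mul_one, ← star_mul, mul_nonsing_inv _ hM, star_one]

theorem dense_det_submatrix_ne_zero {σ τ : ι → n}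
    (hσ : Function.Injective σ) (hτ : Function.Injective τ) :
    Dense {U : unitaryGroup n ℂ | ((U : Matrix n n ℂ).submatrix σ τ).det ≠ 0} := by
  intro U
  obtain ⟨V, hV, hVdet⟩ := exists_mem_unitaryGroup_det_submatrix_ne_zero hσ hτ
  obtain ⟨c, hc, hcdet⟩ :=
    exists_norm_eq_one_det_one_add_smul_ne_zero (star (U : Matrix n n ℂ) * V)
  set W : Matrix n n ℂ := c • (star (U : Matrix n n ℂ) * V)
  have hcc : star c * c = 1 := by
    simp [← Complex.normSq_eq_conj_mul_self, Complex.normSq_eq_norm_sq, hc]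
  have hW : W ∈ unitaryGroup n ℂ := by
    have h1 := mul_mem (star U).2 hV
    rw [mem_unitaryGroup_iff'] at h1 ⊢
    change star (star (U : Matrix n n ℂ) * V) * (star (U : Matrix n n ℂ) * V) = 1 at h1
    simp only [W, star_smul, smul_mul_assoc, mul_smul_comm, smul_smul, mul_comm c, hcc,
      one_smul, h1]
  have hUW : (U : Matrix n n ℂ) * W = c • V := by
    rw [mul_smul_comm, ← mul_assoc, mem_unitaryGroup_iff.1 U.2, one_mul]
  let p : ℂ[X] := (((U : Matrix n n ℂ).map C * ((W.map C + (X : ℂ[X]) • 1) *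
    (1 + (X : ℂ[X]) • W.map C).adjugate)).submatrix σ τ).det
  have hp (z : ℂ) : p.eval z = (((U : Matrix n n ℂ) * ((W + z • 1) *
      (1 + z • W).adjugate)).submatrix σ τ).det := by
    have hC (A : Matrix n n ℂ) : (A.map C).map (evalRingHom z) = A := by ext; simp
    have hX (A : Matrix n n ℂ[X]) :
        ((X : ℂ[X]) • A).map (evalRingHom z) = z • A.map (evalRingHom z) := by ext; simp
    rw [← coe_evalRingHom, RingHom.map_det, RingHom.mapMatrix_apply, ← submatrix_map,
      ← RingHom.mapMatrix_apply]
    simp only [map_mul, map_add, RingHom.map_adjugate, map_one]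
    simp only [RingHom.mapMatrix_apply, hC, hX]
    simp
  have hp0 : p ≠ 0 := by
    intro h
    have := hp 0
    simp [h, hUW, submatrix_smul] at this
    rcases this with h | h
    · simp [h.1] at hc
    · exact hVdet h
  have hdet : ContinuousAt (fun r : ℝ => (1 + (r : ℂ) • W).det) 1 := by fun_prop
  have hev : ∀ᶠ r : ℝ in 𝓝[≠] 1, (1 + (r : ℂ) • W).det ≠ 0 :=
    (hdet.eventually_ne (by simpa using hcdet)).filter_mono nhdsWithin_le_nhds
  have hev' : ∀ᶠ r : ℝ in 𝓝[≠] 1, p.eval (r : ℂ) ≠ 0 :=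
    (Complex.ofReal_injective.tendsto_cofinite.eventually
      (Polynomial.eventually_cofinite_eval_ne_zero hp0)).filter_mono (nhdsNE_le_cofinite 1)
  let g : ℝ → Matrix n n ℂ := fun r => U * ((W + (r : ℂ) • 1) * (1 + (r : ℂ) • W)⁻¹)
  have hg1 : g 1 = U := by
    have : IsUnit (1 + W).det := hcdet.isUnit
    simp [g, add_comm W, mul_nonsing_inv _ this]
  have hg : Tendsto g (𝓝[≠] 1) (𝓝 U) := by
    have : ContinuousAt g 1 := by
      have hinv : ContinuousAt (fun r : ℝ => (1 + (r : ℂ) • W)⁻¹) 1 := by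
        simp only [inv_def, Ring.inverse_eq_inv']
        refine ContinuousAt.smul (hdet.inv₀ (by simpa using hcdet)) (by fun_prop)
      exact continuousAt_const.mul (ContinuousAt.mul (by fun_prop) hinv)
    rw [← hg1]
    exact this.tendsto.mono_left nhdsWithin_le_nhds
  rw [closure_subtype]
  refine mem_closure_of_tendsto hg ?_
  filter_upwards [hev, hev'] with r h1 h2
  refine ⟨⟨g r, mul_mem U.2 (add_smul_one_mul_inv_mem_unitaryGroup hW r h1)⟩, ?_, rfl⟩
  rw [hp] at h2
  simp only [Set.mem_ofPred_eq, g, inv_def, Ring.inverse_eq_inv', mul_smul_comm, submatrix_smul,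
    Pi.smul_apply, det_smul]
  exact mul_ne_zero (pow_ne_zero _ (inv_ne_zero h1)) h2

theorem exists_mem_unitaryGroup_norm_apply_eq (d : ℕ) (hd : d ≠ 0) :
    ∃ F ∈ unitaryGroup (Fin d) ℂ, ∀ i j, ‖F i j‖ = 1 / √d := by
  obtain ⟨ζ, hζ⟩ : ∃ ζ : ℂ, IsPrimitiveRoot ζ d := ⟨_, Complex.isPrimitiveRoot_exp d hd⟩
  have hζ1 : ‖ζ‖ = 1 := hζ.norm'_eq_one hd
  have hζ0 : ζ ≠ 0 := hζ.ne_zero hd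
  have hconj : star ζ = ζ⁻¹ := by
    rw [Complex.inv_def, Complex.normSq_eq_norm_sq, hζ1]; simp
  have hs : ((√d : ℝ) : ℂ) * √d = d := by
    rw [← Complex.ofReal_mul, Real.mul_self_sqrt d.cast_nonneg]; simp
  have hd' : (d : ℂ) ≠ 0 := by exact_mod_cast hd
  refine ⟨of fun i j => ζ ^ (i * j : ℕ) / (√d : ℝ), ?_, fun i j => by simp [hζ1]⟩
  rw [mem_unitaryGroup_iff']
  ext j k
  have hterm (i : Fin d) : star (ζ ^ (i * j : ℕ) / (√d : ℝ)) * (ζ ^ (i * k : ℕ) / (√d : ℝ)) =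
      (ζ ^ (k : ℕ) / ζ ^ (j : ℕ)) ^ (i : ℕ) / d := by
    rw [star_div₀, star_pow, hconj, div_mul_div_comm, Complex.star_def, Complex.conj_ofReal, hs,
      div_pow, ← pow_mul, ← pow_mul, inv_pow, mul_comm (k : ℕ), mul_comm (j : ℕ), mul_comm,
      ← div_eq_mul_inv]
  simp only [mul_apply, star_apply, of_apply, hterm]
  rw [Fin.sum_univ_eq_sum_range (fun i => (ζ ^ (k : ℕ) / ζ ^ (j : ℕ)) ^ i / (d : ℂ)),
    ← Finset.sum_div]
  rcases eq_or_ne j k with rfl | hjk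
  · simp [hζ0, hd']
  · have hne : ζ ^ (k : ℕ) / ζ ^ (j : ℕ) ≠ 1 := by
      rw [Ne, div_eq_one_iff_eq (pow_ne_zero _ hζ0)]
      exact fun h => hjk (Fin.ext (hζ.pow_inj k.2 j.2 h)).symm
    rw [geom_sum_eq hne, div_pow, ← pow_mul, ← pow_mul, mul_comm, pow_mul, mul_comm (j : ℕ),
      pow_mul, hζ.pow_eq_one]
    simp [hjk]

theorem dense_allMinorsNonzero (d : ℕ) :
    Dense {U : unitaryGroup (Fin d) ℂ | AllMinorsNonzero (U : Matrix (Fin d) (Fin d) ℂ)} := by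
  let ι := Σ k : Fin (d + 1), (Fin k ↪ Fin d) × (Fin k ↪ Fin d)
  let f : ι → Set (unitaryGroup (Fin d) ℂ) := fun x =>
    {U | ((U : Matrix (Fin d) (Fin d) ℂ).submatrix x.2.1 x.2.2).det ≠ 0}
  have hf : Dense (⋂ x, f x) := dense_iInter_of_isOpen_of_finite
    (fun x => isOpen_ne_fun (by fun_prop) continuous_const)
    (fun x => dense_det_submatrix_ne_zero x.2.1.injective x.2.2.injective)
  refine hf.mono fun U hU k _ hk σ τ hσ hτ => ?_
  exact Set.mem_iInter.1 hU ⟨⟨k, Nat.lt_succ_of_le hk⟩, ⟨σ, hσ⟩, ⟨τ, hτ⟩⟩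

end Matrix

/-- For every `d ≥ 2` and every `0 < m < 1/√d`, there is a `d × d`
unitary matrix `U` all of whose minors are nonzero and with `m ≤ |U_{ij}|` for all
`i, j` (hence the corresponding pair of bases is COINC with `m ≤ m_AB ≤ 1/√d`). -/
theorem stmt_8 (d : ℕ) (hd : 2 ≤ d) (m : ℝ) (hm0 : 0 < m)
    (hm : m < 1 / Real.sqrt d) :
    ∃ U : Matrix (Fin d) (Fin d) ℂ, U ∈ Matrix.unitaryGroup (Fin d) ℂ ∧
      AllMinorsNonzero U ∧ ∀ i j : Fin d, m ≤ ‖U i j‖ := by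
  obtain ⟨F, hF, hFnorm⟩ := exists_mem_unitaryGroup_norm_apply_eq d (by omega)
  have hopen : IsOpen {U : unitaryGroup (Fin d) ℂ |
      ∀ i j, m < ‖(U : Matrix (Fin d) (Fin d) ℂ) i j‖} := by
    simp only [Set.ofPred_forall]
    exact isOpen_iInter_of_finite fun i => isOpen_iInter_of_finite fun j =>
      isOpen_lt continuous_const (continuous_subtype_val.matrix_elem i j).norm
  obtain ⟨U, hU, hUm⟩ := (dense_allMinorsNonzero d).inter_open_nonempty _ hopen
    ⟨⟨F, hF⟩, fun i j => by simpa only [hFnorm] using hm⟩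
  exact ⟨U, U.2, hUm, fun i j => (hU i j).le⟩
end

section
/- Suppose the bases a and b are completely incompatible (COINC). If S, T are subsets of Fin d with |S| + |T| = d + R for some R ≥ 1, then the subspace span_A(S) ∩ span_B(T) has dimension exactly R, and span_A(S) + span_B(T) = H. -/
/-- Two orthonormal bases are *completely incompatible* (COINC) if
`span_A(S) ∩ span_B(T) = {0}` for all index sets `S`, `T` with `|S| + |T| ≤ d`. -/
def IsCOINC {d : ℕ} {H : Type*} [NormedAddCommGroup H] [InnerProductSpace ℂ H]
    (a b : OrthonormalBasis (Fin d) ℂ H) : Prop :=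
  ∀ S T : Finset (Fin d), S.card + T.card ≤ d →
    Submodule.span ℂ (a '' ↑S) ⊓ Submodule.span ℂ (b '' ↑T) = ⊥

/-- The span of a subfamily of an orthonormal basis has dimension the number of its members. -/
theorem OrthonormalBasis.finrank_span_image_finset {ι 𝕜 E : Type*} [Fintype ι] [RCLike 𝕜]
    [NormedAddCommGroup E] [InnerProductSpace 𝕜 E] (v : OrthonormalBasis ι 𝕜 E) (s : Finset ι) :
    Module.finrank 𝕜 (Submodule.span 𝕜 (v '' ↑s)) = s.card := by
  have hli : LinearIndependent 𝕜 (fun i : s => v i) :=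
    v.orthonormal.linearIndependent.comp _ Subtype.val_injective
  have h := finrank_span_eq_card hli
  rw [Set.image_eq_range]
  simpa using h

/-- If the bases `a`, `b` are COINC and `|S| + |T| = d + R` with
`R ≥ 1`, then `span_A(S) ∩ span_B(T)` has dimension exactly `R` and
`span_A(S) + span_B(T) = H`. -/
theorem stmt_11 {d : ℕ} (hd : 1 ≤ d) {H : Type*} [NormedAddCommGroup H]
    [InnerProductSpace ℂ H] [FiniteDimensional ℂ H]
    (hdim : Module.finrank ℂ H = d)
    (a b : OrthonormalBasis (Fin d) ℂ H)
    (hcoinc : IsCOINC a b)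
    (S T : Finset (Fin d)) (R : ℕ) (hR : 1 ≤ R)
    (hcard : S.card + T.card = d + R) :
    Module.finrank ℂ
        ↥(Submodule.span ℂ (a '' ↑S) ⊓ Submodule.span ℂ (b '' ↑T)) = R ∧
    Submodule.span ℂ (a '' ↑S) ⊔ Submodule.span ℂ (b '' ↑T) = ⊤ := by
  have hS : S.card ≤ d := by simpa using S.card_le_univ
  obtain ⟨U, hU, hUcard⟩ := Finset.exists_subset_card_eq (show d - S.card ≤ T.card by omega)
  have htop : Submodule.span ℂ (a '' ↑S) ⊔ Submodule.span ℂ (b '' ↑T) = ⊤ := by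
    have hsup : Submodule.span ℂ (a '' ↑S) ⊔ Submodule.span ℂ (b '' ↑U) = ⊤ := by
      apply Submodule.eq_top_of_finrank_eq
      have h := Submodule.finrank_sup_add_finrank_inf_eq
        (Submodule.span ℂ (a '' ↑S)) (Submodule.span ℂ (b '' ↑U))
      rw [hcoinc S U (by omega), finrank_bot, a.finrank_span_image_finset,
        b.finrank_span_image_finset] at h
      omega
    refine top_unique (hsup.ge.trans (sup_le_sup_left (Submodule.span_mono ?_) _))
    exact Set.image_mono (Finset.coe_subset.mpr hU)
  refine ⟨?_, htop⟩
  have h := Submodule.finrank_sup_add_finrank_inf_eq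
    (Submodule.span ℂ (a '' ↑S)) (Submodule.span ℂ (b '' ↑T))
  rw [htop, finrank_top, a.finrank_span_image_finset, b.finrank_span_image_finset] at h
  omega
end
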